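/- arXiv:math/0510231 — 2 statements merged into one kernel-verified Lean document; each statement's English description precedes it below -/
import Mathlib

section
/- Let Ω ⊆ ℝ^m and Ω' ⊆ ℝ^n, let α, β ∈ (0,1] and λ ∈ [0,1]. Let f : Ω' → ℝ^d have finite α-Hölder seminorm, and let g, g' : Ω → ℝ^n be bounded maps with finite β-Hölder seminorm such that g(Ω) ⊆ Ω' and g'(Ω) ⊆ Ω'. Then ‖f∘g − f∘g'‖_{Lip^{αβλ}(Ω)} ≤ 2^{1−λ} · ‖f‖_{Lip^α(Ω')} · ‖g − g'‖_{C⁰(Ω)}^{α(1−λ)} · (‖g‖_{Lip^β(Ω)}^α + ‖g'‖_{Lip^β(Ω)}^α)^λ. -/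
open scoped ENNReal

/-- The `α`-Hölder seminorm of a map on a set:
`‖f‖_{Lip^α(s)} = sup_{x ≠ y ∈ s} dist(f x, f y) / dist(x,y)^α` (as an extended real).
For exponent `0` this is the oscillation `sup_{x ≠ y ∈ s} dist(f x, f y)`. -/
noncomputable def eHolderSemi {X Y : Type*} [PseudoEMetricSpace X] [PseudoEMetricSpace Y]
    (α : ℝ) (f : X → Y) (s : Set X) : ℝ≥0∞ :=
  ⨆ (x : X) (_ : x ∈ s) (y : X) (_ : y ∈ s) (_ : x ≠ y), edist (f x) (f y) / edist x y ^ α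

/-- The sup norm `‖f‖_{C⁰(s)} = sup_{x ∈ s} ‖f x‖` (as an extended real). -/
noncomputable def eSupNorm {X Y : Type*} [NNNorm Y] (f : X → Y) (s : Set X) : ℝ≥0∞ :=
  ⨆ (x : X) (_ : x ∈ s), (‖f x‖₊ : ℝ≥0∞)

theorem edist_le_eHolderSemi_aux {X Y : Type*} [MetricSpace X] [PseudoEMetricSpace Y]
    {α : ℝ} (hα : 0 ≤ α) (f : X → Y) (s : Set X) {x y : X} (hx : x ∈ s) (hy : y ∈ s) :
    edist (f x) (f y) ≤ eHolderSemi α f s * edist x y ^ α := by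
  by_cases hxy : x = y
  · subst hxy; simp
  · have h0 : edist x y ≠ 0 := by simpa using hxy
    have h1 : edist x y ^ α ≠ 0 := by
      simp [ENNReal.rpow_eq_zero_iff, h0, edist_ne_top]
    have h2 : edist x y ^ α ≠ ∞ := ENNReal.rpow_ne_top_of_nonneg hα (edist_ne_top x y)
    rw [← ENNReal.div_le_iff h1 h2]
    unfold eHolderSemi
    exact le_iSup_of_le x (le_iSup_of_le hx (le_iSup_of_le y (le_iSup_of_le hy
      (le_iSup_of_le hxy le_rfl))))

/-- Interpolated continuity estimate for composition (variation in the inner map): if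
`f` is `α`-Hölder on `Ω'` and `g, g' : Ω → Ω'` are bounded and `β`-Hölder, then for all
`λ ∈ [0,1]`,
`‖f∘g − f∘g'‖_{Lip^{αβλ}(Ω)} ≤ 2^{1−λ} ‖f‖_{Lip^α(Ω')} ‖g−g'‖_{C⁰(Ω)}^{α(1−λ)}
  (‖g‖_{Lip^β(Ω)}^α + ‖g'‖_{Lip^β(Ω)}^α)^λ`. -/
theorem eHolderSemi_comp_sub_comp_right_interp {m n d : ℕ}
    (Ω : Set (EuclideanSpace ℝ (Fin m))) (Ω' : Set (EuclideanSpace ℝ (Fin n)))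
    (α β lam : ℝ) (hα0 : 0 < α) (hα1 : α ≤ 1) (hβ0 : 0 < β) (hβ1 : β ≤ 1)
    (hlam0 : 0 ≤ lam) (hlam1 : lam ≤ 1)
    (f : EuclideanSpace ℝ (Fin n) → EuclideanSpace ℝ (Fin d))
    (g g' : EuclideanSpace ℝ (Fin m) → EuclideanSpace ℝ (Fin n))
    (hfα : eHolderSemi α f Ω' ≠ ∞)
    (hg0 : eSupNorm g Ω ≠ ∞) (hgβ : eHolderSemi β g Ω ≠ ∞)
    (hg'0 : eSupNorm g' Ω ≠ ∞) (hg'β : eHolderSemi β g' Ω ≠ ∞)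
    (hgmaps : Set.MapsTo g Ω Ω') (hg'maps : Set.MapsTo g' Ω Ω') :
    eHolderSemi (α * β * lam) (fun x => f (g x) - f (g' x)) Ω ≤
      (2 : ℝ≥0∞) ^ (1 - lam) * eHolderSemi α f Ω' *
        eSupNorm (fun x => g x - g' x) Ω ^ (α * (1 - lam)) *
        (eHolderSemi β g Ω ^ α + eHolderSemi β g' Ω ^ α) ^ lam := by
  conv_lhs => unfold eHolderSemi
  refine iSup_le fun x => iSup_le fun hx => iSup_le fun y => iSup_le fun hy => iSup_le fun hxy => ?_
  set H := eHolderSemi α f Ω'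
  set S := eSupNorm (fun x => g x - g' x) Ω
  set G := eHolderSemi β g Ω
  set G' := eHolderSemi β g' Ω
  set e := edist x y with he
  set D := edist (f (g x) - f (g' x)) (f (g y) - f (g' y)) with hD
  have hl1 : 0 ≤ 1 - lam := by linarith
  have hS : ∀ z ∈ Ω, edist (f (g z)) (f (g' z)) ≤ H * S ^ α := by
    intro z hz
    refine (edist_le_eHolderSemi_aux hα0.le f Ω' (hgmaps hz) (hg'maps hz)).trans ?_
    have : edist (g z) (g' z) ≤ S := by
      rw [edist_eq_enorm_sub]
      exact le_iSup_of_le (f := fun x => ⨆ (_ : x ∈ Ω), (‖g x - g' x‖₊ : ℝ≥0∞)) z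
        (le_iSup_of_le hz le_rfl)
    gcongr
  have hHol : ∀ k : EuclideanSpace ℝ (Fin m) → EuclideanSpace ℝ (Fin n), Set.MapsTo k Ω Ω' →
      edist (f (k x)) (f (k y)) ≤ H * (eHolderSemi β k Ω ^ α * e ^ (α * β)) := by
    intro k hk
    refine (edist_le_eHolderSemi_aux hα0.le f Ω' (hk hx) (hk hy)).trans ?_
    have := edist_le_eHolderSemi_aux hβ0.le k Ω hx hy
    rw [mul_comm α β, ENNReal.rpow_mul, ← ENNReal.mul_rpow_of_nonneg _ _ hα0.le]
    gcongr
  have h1 : D ≤ 2 * (H * S ^ α) := by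
    have : D ≤ edist (f (g x)) (f (g' x)) + edist (f (g y)) (f (g' y)) := by
      simp only [hD, edist_eq_enorm_sub]
      exact enorm_sub_le
    rw [two_mul]
    exact this.trans (add_le_add (hS x hx) (hS y hy))
  have h2 : D ≤ H * ((G ^ α + G' ^ α) * e ^ (α * β)) := by
    have : D ≤ edist (f (g x)) (f (g y)) + edist (f (g' x)) (f (g' y)) := by
      simp only [hD, edist_eq_enorm_sub]
      rw [sub_sub_sub_comm]
      exact enorm_sub_le
    rw [add_mul, mul_add]
    exact this.trans (add_le_add (hHol g hgmaps) (hHol g' hg'maps))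
  have h0 : e ≠ 0 := by simpa [he] using hxy
  have het : e ≠ ∞ := edist_ne_top x y
  have hp : 0 ≤ α * β * lam := by positivity
  have h3 : e ^ (α * β * lam) ≠ 0 := by
    simp [ENNReal.rpow_eq_zero_iff, h0, het]
  rw [ENNReal.div_le_iff h3 (ENNReal.rpow_ne_top_of_nonneg hp het)]
  have split : ∀ a : ℝ≥0∞, a = a ^ (1 - lam) * a ^ lam := by
    intro a
    rw [← ENNReal.rpow_add_of_nonneg _ _ hl1 hlam0]; simp
  calc D = D ^ (1 - lam) * D ^ lam := split D
    _ ≤ (2 * (H * S ^ α)) ^ (1 - lam) * (H * ((G ^ α + G' ^ α) * e ^ (α * β))) ^ lam := by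
        gcongr
    _ = 2 ^ (1 - lam) * (H ^ (1 - lam) * H ^ lam) * S ^ (α * (1 - lam)) *
        (G ^ α + G' ^ α) ^ lam * e ^ (α * β * lam) := by
        rw [ENNReal.mul_rpow_of_nonneg _ _ hl1, ENNReal.mul_rpow_of_nonneg _ _ hl1,
          ENNReal.mul_rpow_of_nonneg _ _ hlam0, ENNReal.mul_rpow_of_nonneg _ _ hlam0,
          ← ENNReal.rpow_mul, ← ENNReal.rpow_mul]
        ring
    _ = _ := by rw [← split H]
end

section
/- Let Ω ⊆ ℝ^m and Ω' ⊆ ℝ^n, let α, β ∈ (0,1] and λ ∈ [0,1]. Let f, f' : Ω' → ℝ^d be bounded maps with finite α-Hölder seminorm, and let g : Ω → ℝ^n have finite β-Hölder seminorm with g(Ω) ⊆ Ω'. Then ‖f∘g − f'∘g‖_{Lip^{αβλ}(Ω)} ≤ 2^{1−λ} · ‖f − f'‖_{C⁰(Ω')}^{1−λ} · (‖f‖_{Lip^α(Ω')} + ‖f'‖_{Lip^α(Ω')})^λ · ‖g‖_{Lip^β(Ω)}^{λα}. -/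
open scoped ENNReal

theorem edist_le_eHolderSemi_mul {X Y : Type*} [MetricSpace X] [PseudoEMetricSpace Y]
    (α : ℝ) (f : X → Y) (s : Set X) {x y : X} (hx : x ∈ s) (hy : y ∈ s) :
    edist (f x) (f y) ≤ eHolderSemi α f s * edist x y ^ α := by
  by_cases hxy : x = y
  · subst hxy
    simp
  · have h0 : edist x y ≠ 0 := by simpa using hxy
    have h1 : edist x y ≠ ∞ := edist_ne_top x y
    have h : edist (f x) (f y) / edist x y ^ α ≤ eHolderSemi α f s := by
      unfold eHolderSemi
      exact le_iSup_of_le x (le_iSup_of_le hx (le_iSup_of_le y (le_iSup_of_le hy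
        (le_iSup_of_le hxy le_rfl))))
    have h2 : edist x y ^ α ≠ 0 := by
      simp [ENNReal.rpow_eq_zero_iff, h0, h1]
    have h3 : edist x y ^ α ≠ ∞ := by
      simp [ENNReal.rpow_eq_top_iff, h0, h1]
    exact (ENNReal.div_le_iff h2 h3).1 h

/-- Interpolated continuity estimate for composition (variation in the outer map): if
`f, f'` are bounded and `α`-Hölder on `Ω'` and `g : Ω → Ω'` is `β`-Hölder, then for all
`λ ∈ [0,1]`,
`‖f∘g − f'∘g‖_{Lip^{αβλ}(Ω)} ≤ 2^{1−λ} ‖f−f'‖_{C⁰(Ω')}^{1−λ}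
  (‖f‖_{Lip^α(Ω')} + ‖f'‖_{Lip^α(Ω')})^λ ‖g‖_{Lip^β(Ω)}^{λα}`. -/
theorem eHolderSemi_comp_sub_comp_left_interp {m n d : ℕ}
    (Ω : Set (EuclideanSpace ℝ (Fin m))) (Ω' : Set (EuclideanSpace ℝ (Fin n)))
    (α β lam : ℝ) (hα0 : 0 < α) (hα1 : α ≤ 1) (hβ0 : 0 < β) (hβ1 : β ≤ 1)
    (hlam0 : 0 ≤ lam) (hlam1 : lam ≤ 1)
    (f f' : EuclideanSpace ℝ (Fin n) → EuclideanSpace ℝ (Fin d))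
    (g : EuclideanSpace ℝ (Fin m) → EuclideanSpace ℝ (Fin n))
    (hf0 : eSupNorm f Ω' ≠ ∞) (hfα : eHolderSemi α f Ω' ≠ ∞)
    (hf'0 : eSupNorm f' Ω' ≠ ∞) (hf'α : eHolderSemi α f' Ω' ≠ ∞)
    (hgβ : eHolderSemi β g Ω ≠ ∞)
    (hgmaps : Set.MapsTo g Ω Ω') :
    eHolderSemi (α * β * lam) (fun x => f (g x) - f' (g x)) Ω ≤
      (2 : ℝ≥0∞) ^ (1 - lam) * eSupNorm (fun y => f y - f' y) Ω' ^ (1 - lam) *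
        (eHolderSemi α f Ω' + eHolderSemi α f' Ω') ^ lam *
        eHolderSemi β g Ω ^ (lam * α) := by
  unfold eHolderSemi
  refine iSup_le fun x => iSup_le fun hx => iSup_le fun y => iSup_le fun hy => iSup_le fun hxy => ?_
  change _ ≤ (2 : ℝ≥0∞) ^ (1 - lam) * eSupNorm (fun y => f y - f' y) Ω' ^ (1 - lam) *
        (eHolderSemi α f Ω' + eHolderSemi α f' Ω') ^ lam *
        eHolderSemi β g Ω ^ (lam * α)
  have h0 : edist x y ≠ 0 := by simpa using hxy
  have h1 : edist x y ≠ ∞ := edist_ne_top x y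
  have h2 : edist x y ^ (α * β * lam) ≠ 0 := by
    simp [ENNReal.rpow_eq_zero_iff, h0, h1]
  have h3 : edist x y ^ (α * β * lam) ≠ ∞ := by
    simp [ENNReal.rpow_eq_top_iff, h0, h1]
  rw [ENNReal.div_le_iff h2 h3]
  set S := eSupNorm (fun y => f y - f' y) Ω' with hS
  have hsup : ∀ z ∈ Ω, ‖f (g z) - f' (g z)‖ₑ ≤ S := fun z hz =>
    le_iSup₂_of_le (f := fun (w : EuclideanSpace ℝ (Fin n)) (_ : w ∈ Ω') =>
      (‖f w - f' w‖₊ : ℝ≥0∞)) (g z) (hgmaps hz) le_rfl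
  set E := edist (f (g x) - f' (g x)) (f (g y) - f' (g y)) with hE
  have hE1 : E ≤ 2 * S := by
    rw [hE, edist_eq_enorm_sub, two_mul]
    exact enorm_sub_le.trans (add_le_add (hsup x hx) (hsup y hy))
  have hE2 : E ≤ (eHolderSemi α f Ω' + eHolderSemi α f' Ω') *
      (eHolderSemi β g Ω * edist x y ^ β) ^ α := by
    have ha := edist_le_eHolderSemi_mul α f Ω' (hgmaps hx) (hgmaps hy)
    have hb := edist_le_eHolderSemi_mul α f' Ω' (hgmaps hx) (hgmaps hy)
    have hc := edist_le_eHolderSemi_mul β g Ω hx hy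
    have hd : E ≤ edist (f (g x)) (f (g y)) + edist (f' (g x)) (f' (g y)) := by
      rw [hE, edist_eq_enorm_sub, edist_eq_enorm_sub, edist_eq_enorm_sub, sub_sub_sub_comm]
      exact enorm_sub_le
    refine hd.trans ((add_le_add ha hb).trans ?_)
    rw [← add_mul]
    gcongr
  have hsplit : E = E ^ (1 - lam) * E ^ lam := by
    rw [← ENNReal.rpow_add_of_nonneg _ _ (by linarith) hlam0]
    simp
  have h1l : 0 ≤ 1 - lam := by linarith
  calc E = E ^ (1 - lam) * E ^ lam := hsplit
    _ ≤ (2 * S) ^ (1 - lam) * ((eHolderSemi α f Ω' + eHolderSemi α f' Ω') *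
      (eHolderSemi β g Ω * edist x y ^ β) ^ α) ^ lam := by gcongr
    _ = _ := by
      rw [ENNReal.mul_rpow_of_nonneg _ _ h1l, ENNReal.mul_rpow_of_nonneg _ _ hlam0,
        ENNReal.mul_rpow_of_nonneg _ _ hα0.le, ENNReal.mul_rpow_of_nonneg _ _ hlam0,
        ← ENNReal.rpow_mul, ← ENNReal.rpow_mul, ← ENNReal.rpow_mul,
        mul_comm α lam, show β * (lam * α) = α * β * lam by ring]
      simp only [mul_assoc]
end
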